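/- Let N ≥ 3 and k ≥ 3 be integers, let δ be a divisor of N with 1 ≤ δ < N/2, let λ₀ ∈ ℤ with gcd(λ₀, gcd(δ, N/δ)) = 1, let χ₁ be a Dirichlet character modulo N/δ and χ₂ a Dirichlet character modulo δ, and let χ be the Dirichlet character modulo N obtained as the product of the level-raisings of χ₁ and χ₂. Define F := Σ_{(a,λ₂) ∈ I} χ₁(a)·χ₂(λ₂)^{-1}·E_k^{(1)}((aδ, λ₂), N), where I := {(a,λ₂) ∈ ℤ² : 0 ≤ a ≤ N/δ − 1, gcd(a, N/δ) = 1, 0 ≤ λ₂ ≤ δ − 1, gcd(λ₂, δ) = 1, a·λ₂ ≡ λ₀ (mod gcd(δ, N/δ))}, and define F₀ := Σ_{1 ≤ m ≤ N, gcd(m,N)=1} χ(m)^{-1}·E_k(·, (0,m), N). Then for every γ = [[a,b],[c,d]] ∈ Γ₀(N): F|_k γ = χ(d)·F and F₀|_k γ = χ(d)·F₀. (Hence F and F₀ are Eisenstein series of weight k with nebentypus χ.) -/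

import Mathlib

open scoped MatrixGroups
open Complex UpperHalfPlane

noncomputable section

abbrev SL2Z := Matrix.SpecialLinearGroup (Fin 2) ℤ

/-- weight `k` slash action of `γ ∈ SL(2,ℤ)` on functions `ℍ → ℂ`. -/
def slashf (k : ℤ) (γ : SL2Z) (f : ℍ → ℂ) : ℍ → ℂ :=
  fun τ => (((γ 1 0 : ℤ) : ℂ) * (τ : ℂ) + ((γ 1 1 : ℤ) : ℂ)) ^ (-k) * f (γ • τ)

def epsN (N : ℕ) : ℂ := if 3 ≤ N then 1 else 1/2

/-- normalized Eisenstein series of weight `k` on `Γ(N)` -/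
def Ek (k N : ℕ) (lam : ZMod N × ZMod N) : ℍ → ℂ :=
  fun τ => epsN N * ∑' cd : ℤ × ℤ,
    if Int.gcd cd.1 cd.2 = 1 ∧ (cd.1 : ZMod N) = lam.1 ∧ (cd.2 : ZMod N) = lam.2
    then ((cd.1 : ℂ) * (τ : ℂ) + (cd.2 : ℂ)) ^ (-(k : ℤ)) else 0

/-- the orbital sum `E_k^{(1)}(λ, N)` for `Γ₁(N)`. -/
def Ek1 (k N : ℕ) (lam : ℤ × ℤ) : ℍ → ℂ :=
  fun τ => ∑ n ∈ Finset.range (N / Int.gcd lam.1 (N : ℤ)),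
    Ek k N ((lam.1 : ZMod N),
      ((lam.2 + (Int.gcd lam.1 (N : ℤ) : ℤ) * (n : ℤ) : ℤ) : ZMod N)) τ

/-- the nebentypus Eisenstein series `E^{(0)}_{k,χ₁,χ₂}((δ,λ₀), N)`. -/
def E0chi (k N δ : ℕ) (l₀ : ℤ)
    (χ₁ : DirichletCharacter ℂ (N / δ)) (χ₂ : DirichletCharacter ℂ δ) : ℍ → ℂ :=
  fun τ => ∑ a ∈ Finset.range (N / δ), ∑ l ∈ Finset.range δ,
    if Nat.gcd a (N / δ) = 1 ∧ Nat.gcd l δ = 1 ∧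
        (((a * l : ℕ) : ZMod (Nat.gcd δ (N / δ))) = ((l₀ : ℤ) : ZMod (Nat.gcd δ (N / δ))))
    then χ₁ (a : ZMod (N / δ)) * (χ₂ (l : ZMod δ))⁻¹ *
      Ek1 k N (((a : ℤ) * (δ : ℤ)), (l : ℤ)) τ
    else 0

/-- the nebentypus Eisenstein series `E^{(0)}_{k,χ}((0,1), N)`. -/
def F0chi (k N : ℕ) (χ : DirichletCharacter ℂ N) : ℍ → ℂ :=
  fun τ => ∑ m ∈ Finset.Icc 1 N,
    if Nat.gcd m N = 1 then (χ (m : ZMod N))⁻¹ * Ek k N ((0 : ZMod N), (m : ZMod N)) τ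
    else 0

/-- Right multiplication by `γ` as a permutation of `ℤ × ℤ`. -/
def rowMulEquiv (γ : SL2Z) : ℤ × ℤ ≃ ℤ × ℤ where
  toFun v := (v.1 * γ 0 0 + v.2 * γ 1 0, v.1 * γ 0 1 + v.2 * γ 1 1)
  invFun v := (v.1 * γ 1 1 - v.2 * γ 1 0, v.2 * γ 0 0 - v.1 * γ 0 1)
  left_inv v := by
    have h := Matrix.SpecialLinearGroup.det_coe γ
    rw [Matrix.det_fin_two] at h
    ext
    · linear_combination v.1 * h
    · linear_combination v.2 * h
  right_inv v := by
    have h := Matrix.SpecialLinearGroup.det_coe γ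
    rw [Matrix.det_fin_two] at h
    ext
    · linear_combination v.1 * h
    · linear_combination v.2 * h

lemma gcd_rowMul_eq_one_iff (γ : SL2Z) (x y : ℤ) :
    Int.gcd (x * γ 0 0 + y * γ 1 0) (x * γ 0 1 + y * γ 1 1) = 1 ↔ Int.gcd x y = 1 := by
  have h := Matrix.SpecialLinearGroup.det_coe γ
  rw [Matrix.det_fin_two] at h
  rw [← Int.isCoprime_iff_gcd_eq_one, ← Int.isCoprime_iff_gcd_eq_one]
  constructor
  · rintro ⟨u, v, huv⟩
    exact ⟨u * γ 0 0 + v * γ 0 1, u * γ 1 0 + v * γ 1 1, by linear_combination huv⟩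
  · rintro ⟨u, v, huv⟩
    exact ⟨u * γ 1 1 - v * γ 0 1, v * γ 0 0 - u * γ 1 0,
      by linear_combination huv + (u * x + v * y) * h⟩

lemma Ek_slash (k N : ℕ) (lam : ZMod N × ZMod N) (γ : SL2Z) (τ : ℍ) :
    (((γ 1 0 : ℤ) : ℂ) * (τ : ℂ) + ((γ 1 1 : ℤ) : ℂ)) ^ (-(k : ℤ)) * Ek k N lam (γ • τ) =
      Ek k N (lam.1 * (γ 0 0 : ℤ) + lam.2 * (γ 1 0 : ℤ),
        lam.1 * (γ 0 1 : ℤ) + lam.2 * (γ 1 1 : ℤ)) τ := by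
  have h := Matrix.SpecialLinearGroup.det_coe γ
  rw [Matrix.det_fin_two] at h
  have hmod : ((γ 0 0 : ℤ) : ZMod N) * (γ 1 1 : ℤ) - (γ 0 1 : ℤ) * (γ 1 0 : ℤ) = 1 := by
    exact_mod_cast congrArg (Int.cast : ℤ → ZMod N) h
  have hden : ((γ 1 0 : ℤ) : ℂ) * (τ : ℂ) + ((γ 1 1 : ℤ) : ℂ) ≠ 0 := by
    simpa [UpperHalfPlane.denom] using UpperHalfPlane.denom_ne_zero (γ : GL (Fin 2) ℝ) τ
  unfold Ek
  rw [mul_left_comm, ← tsum_mul_left]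
  congr 1
  symm
  rw [← (rowMulEquiv γ).tsum_eq]
  refine tsum_congr fun ⟨x, y⟩ => ?_
  have hcond : ((x : ZMod N) = lam.1 ∧ (y : ZMod N) = lam.2) ↔
      (((x * γ 0 0 + y * γ 1 0 : ℤ) : ZMod N) = lam.1 * (γ 0 0 : ℤ) + lam.2 * (γ 1 0 : ℤ) ∧
        ((x * γ 0 1 + y * γ 1 1 : ℤ) : ZMod N) =
          lam.1 * (γ 0 1 : ℤ) + lam.2 * (γ 1 1 : ℤ)) := by
    push_cast
    constructor
    · rintro ⟨hx, hy⟩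
      rw [hx, hy]
      exact ⟨rfl, rfl⟩
    · rintro ⟨hx, hy⟩
      constructor
      · linear_combination (γ 1 1 : ZMod N) * hx - (γ 1 0 : ZMod N) * hy - (x - lam.1) * hmod
      · linear_combination (γ 0 0 : ZMod N) * hy - (γ 0 1 : ZMod N) * hx - (y - lam.2) * hmod
  simp only [rowMulEquiv, Equiv.coe_fn_mk, gcd_rowMul_eq_one_iff, ← hcond, mul_ite, mul_zero]
  congr 1
  rw [← mul_zpow]
  congr 1
  symm
  rw [UpperHalfPlane.coe_specialLinearGroup_apply]
  simp only [algebraMap_int_eq, eq_intCast, Complex.ofReal_intCast]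
  field_simp
  push_cast
  ring

lemma sum_range_natCast_zmod {R : Type*} [AddCommMonoid R] (n : ℕ) [NeZero n] (f : ZMod n → R) :
    ∑ i ∈ Finset.range n, f (i : ZMod n) = ∑ x : ZMod n, f x := by
  refine Finset.sum_nbij' (fun i => (i : ZMod n)) ZMod.val ?_ ?_ ?_ ?_ ?_
  · simp
  · simp [ZMod.val_lt]
  · intro i hi
    exact ZMod.val_cast_of_lt (Finset.mem_range.mp hi)
  · simp
  · simp

lemma sum_Icc_natCast_zmod {R : Type*} [AddCommMonoid R] (n : ℕ) [NeZero n] (f : ZMod n → R) :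
    ∑ i ∈ Finset.Icc 1 n, f (i : ZMod n) = ∑ x : ZMod n, f x := by
  rw [← Finset.Ico_add_one_right_eq_Icc, Finset.sum_Ico_eq_sum_range, Nat.add_sub_cancel]
  simp only [Nat.cast_add]
  rw [sum_range_natCast_zmod n fun x => f ((1 : ℕ) + x)]
  exact Equiv.sum_comp (Equiv.addLeft _) f

lemma sum_range_sum_range_add_mul {R : Type*} [AddCommMonoid R] (m n : ℕ) (f : ℕ → R) :
    ∑ l ∈ Finset.range m, ∑ i ∈ Finset.range n, f (l + m * i) =
      ∑ j ∈ Finset.range (m * n), f j := by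
  rw [← Finset.sum_product']
  refine Finset.sum_nbij' (fun p => p.1 + m * p.2) (fun j => (j % m, j / m)) ?_ ?_ ?_ ?_ ?_
  · rintro ⟨l, i⟩ h
    simp only [Finset.mem_product, Finset.mem_range] at h ⊢
    nlinarith
  · intro j h
    have h := Finset.mem_range.mp h
    have hm : 0 < m := Nat.pos_of_ne_zero (by rintro rfl; simp at h)
    simp only [Finset.mem_product, Finset.mem_range]
    exact ⟨Nat.mod_lt _ hm, Nat.div_lt_of_lt_mul h⟩
  · rintro ⟨l, i⟩ h
    simp only [Finset.mem_product, Finset.mem_range] at h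
    have hm : 0 < m := by omega
    simp [Nat.add_mul_div_left _ _ hm, Nat.mod_eq_of_lt h.1, Nat.div_eq_of_lt h.1]
  · intro j _
    exact Nat.mod_add_div j m
  · simp

/-- The summand of `E0chi`, indexed by residue classes. -/
def E0chiTerm (k N δ : ℕ) (hdvd : δ ∣ N) (l₀ : ℤ)
    (χ₁ : DirichletCharacter ℂ (N / δ)) (χ₂ : DirichletCharacter ℂ δ)
    (p : ZMod (N / δ) × ZMod N) (τ : ℍ) : ℂ :=
  if ZMod.castHom (Nat.gcd_dvd_right δ (N / δ)) (ZMod (Nat.gcd δ (N / δ))) p.1 *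
      ZMod.castHom ((Nat.gcd_dvd_left δ (N / δ)).trans hdvd) (ZMod (Nat.gcd δ (N / δ))) p.2 =
        (l₀ : ZMod (Nat.gcd δ (N / δ)))
  then χ₁ p.1 * (χ₂ (ZMod.castHom hdvd (ZMod δ) p.2))⁻¹ *
    Ek k N (((p.1.val * δ : ℕ) : ZMod N), p.2) τ
  else 0

lemma E0chi_eq_sum (k N δ : ℕ) [NeZero N] [NeZero (N / δ)] (hdvd : δ ∣ N) (l₀ : ℤ)
    (χ₁ : DirichletCharacter ℂ (N / δ)) (χ₂ : DirichletCharacter ℂ δ) (τ : ℍ) :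
    E0chi k N δ l₀ χ₁ χ₂ τ =
      ∑ p : ZMod (N / δ) × ZMod N, E0chiTerm k N δ hdvd l₀ χ₁ χ₂ p τ := by
  have hmul : δ * (N / δ) = N := Nat.mul_div_cancel' hdvd
  rw [Fintype.sum_prod_type, ← sum_range_natCast_zmod]
  unfold E0chi
  refine Finset.sum_congr rfl fun a ha => ?_
  rw [← sum_range_natCast_zmod]
  have hsplit := sum_range_sum_range_add_mul δ (N / δ)
    fun i => E0chiTerm k N δ hdvd l₀ χ₁ χ₂ (a, (i : ZMod N)) τ
  rw [hmul] at hsplit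
  rw [← hsplit]
  refine Finset.sum_congr rfl fun l _ => ?_
  have hval : (a : ZMod (N / δ)).val = a := ZMod.val_cast_of_lt (Finset.mem_range.mp ha)
  have hδg : ((δ : ℕ) : ZMod (Nat.gcd δ (N / δ))) = 0 :=
    (ZMod.natCast_eq_zero_iff _ _).mpr (Nat.gcd_dvd_left _ _)
  have hterm (i : ℕ) : E0chiTerm k N δ hdvd l₀ χ₁ χ₂ (a, ((l + δ * i : ℕ) : ZMod N)) τ =
      if ((a * l : ℕ) : ZMod (Nat.gcd δ (N / δ))) = (l₀ : ZMod (Nat.gcd δ (N / δ)))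
      then χ₁ (a : ZMod (N / δ)) * (χ₂ (l : ZMod δ))⁻¹ *
        Ek k N (((a * δ : ℕ) : ZMod N), ((l + δ * i : ℕ) : ZMod N)) τ
      else 0 := by
    simp only [E0chiTerm, hval, map_natCast]
    simp [hδg]
  simp only [hterm]
  by_cases ha1 : Nat.gcd a (N / δ) = 1
  · by_cases hl1 : Nat.gcd l δ = 1
    · have hgcd : Int.gcd ((a : ℤ) * δ) N = δ := by
        rw [← Nat.cast_mul, Int.gcd_natCast_natCast]
        conv_lhs => rw [← hmul, mul_comm δ, Nat.gcd_mul_right, ha1, one_mul]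
      simp only [ha1, hl1, true_and]
      split_ifs with hc
      · simp only [Ek1, hgcd, Finset.mul_sum]
        push_cast
        rfl
      · simp
    · have : χ₂ (l : ZMod δ) = 0 :=
        χ₂.map_nonunit (by rwa [ZMod.isUnit_iff_coprime])
      simp [hl1, this]
  · have : χ₁ (a : ZMod (N / δ)) = 0 :=
      χ₁.map_nonunit (by rwa [ZMod.isUnit_iff_coprime])
    simp [ha1, this]

lemma F0chi_eq_sum (k N : ℕ) [NeZero N] (χ : DirichletCharacter ℂ N) (τ : ℍ) :
    F0chi k N χ τ = ∑ m : ZMod N, (χ m)⁻¹ * Ek k N (0, m) τ := by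
  rw [← sum_Icc_natCast_zmod]
  refine Finset.sum_congr rfl fun m _ => ?_
  split_ifs with h
  · rfl
  · rw [χ.map_nonunit (by rwa [ZMod.isUnit_iff_coprime]), inv_zero, zero_mul]

lemma Gamma0_upper_left_mul_lower_right {N : ℕ} {γ : SL2Z}
    (hγ : γ ∈ CongruenceSubgroup.Gamma0 N) {M : ℕ} (hM : M ∣ N) :
    ((γ 0 0 : ℤ) : ZMod M) * ((γ 1 1 : ℤ) : ZMod M) = 1 := by
  have h := Matrix.SpecialLinearGroup.det_coe γ
  rw [Matrix.det_fin_two] at h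
  have hc : ((γ 1 0 : ℤ) : ZMod M) = 0 := by
    rw [CongruenceSubgroup.Gamma0_mem, ZMod.intCast_zmod_eq_zero_iff_dvd] at hγ
    rw [ZMod.intCast_zmod_eq_zero_iff_dvd]
    exact (Int.natCast_dvd_natCast.mpr hM).trans hγ
  have h' := congrArg (Int.cast : ℤ → ZMod M) h
  push_cast at h'
  rw [hc, mul_zero, sub_zero] at h'
  exact h'

lemma F0chi_slash (k N : ℕ) [NeZero N] (χ : DirichletCharacter ℂ N) {γ : SL2Z}
    (hγ : γ ∈ CongruenceSubgroup.Gamma0 N) (τ : ℍ) :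
    slashf (k : ℤ) γ (F0chi k N χ) τ = χ ((γ 1 1 : ℤ) : ZMod N) * F0chi k N χ τ := by
  have had := Gamma0_upper_left_mul_lower_right hγ dvd_rfl
  have hc := CongruenceSubgroup.Gamma0_mem.mp hγ
  have hd : IsUnit ((γ 1 1 : ℤ) : ZMod N) := .of_mul_eq_one_right _ had
  have hχ : χ ((γ 1 1 : ℤ) : ZMod N) ≠ 0 := (hd.map χ).ne_zero
  unfold slashf
  rw [F0chi_eq_sum, F0chi_eq_sum, Finset.mul_sum, Finset.mul_sum]
  refine Fintype.sum_bijective (· * ((γ 1 1 : ℤ) : ZMod N))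
    (Finite.injective_iff_bijective.mp hd.mul_left_injective) _ _ fun m => ?_
  rw [mul_left_comm, Ek_slash, map_mul]
  simp only [hc, mul_zero, zero_mul, zero_add]
  field_simp

lemma natCast_val_mul_intCast_mul {N δ : ℕ} (hdvd : δ ∣ N) [NeZero (N / δ)]
    (a : ZMod (N / δ)) (x : ℤ) :
    (((a * (x : ZMod (N / δ))).val * δ : ℕ) : ZMod N) = ((a.val * δ : ℕ) : ZMod N) * x := by
  have h : (((a * (x : ZMod (N / δ))).val : ℤ) : ZMod (N / δ)) = ((a.val * x : ℤ)) := by simp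
  rw [ZMod.intCast_eq_intCast_iff_dvd_sub] at h
  have h2 : (N : ℤ) ∣ a.val * x * δ - (a * (x : ZMod (N / δ))).val * δ := by
    rw [← sub_mul]
    conv_lhs => rw [← Nat.div_mul_cancel hdvd, Nat.cast_mul]
    exact mul_dvd_mul_right h _
  rw [← ZMod.intCast_eq_intCast_iff_dvd_sub] at h2
  push_cast at h2 ⊢
  rw [h2]
  ring

lemma E0chi_slash (k N δ : ℕ) [NeZero N] [NeZero (N / δ)] (hdvd : δ ∣ N) (l₀ : ℤ)
    (χ₁ : DirichletCharacter ℂ (N / δ)) (χ₂ : DirichletCharacter ℂ δ) {γ : SL2Z}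
    (hγ : γ ∈ CongruenceSubgroup.Gamma0 N) (τ : ℍ) :
    slashf (k : ℤ) γ (E0chi k N δ l₀ χ₁ χ₂) τ =
      χ₁ ((γ 1 1 : ℤ) : ZMod (N / δ)) * χ₂ ((γ 1 1 : ℤ) : ZMod δ) *
        E0chi k N δ l₀ χ₁ χ₂ τ := by
  have hMN : N / δ ∣ N := Nat.div_dvd_of_dvd hdvd
  have hgN : Nat.gcd δ (N / δ) ∣ N := (Nat.gcd_dvd_left δ (N / δ)).trans hdvd
  have hadN := Gamma0_upper_left_mul_lower_right hγ (dvd_refl N)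
  have hadM := Gamma0_upper_left_mul_lower_right hγ hMN
  have hadδ := Gamma0_upper_left_mul_lower_right hγ hdvd
  have hadg := Gamma0_upper_left_mul_lower_right hγ hgN
  have hc := CongruenceSubgroup.Gamma0_mem.mp hγ
  have hδg : ((δ : ℕ) : ZMod (Nat.gcd δ (N / δ))) = 0 :=
    (ZMod.natCast_eq_zero_iff _ _).mpr (Nat.gcd_dvd_left _ _)
  have hχ₁ : χ₁ ((γ 0 0 : ℤ) : ZMod (N / δ)) * χ₁ ((γ 1 1 : ℤ) : ZMod (N / δ)) = 1 := by
    rw [← map_mul, hadM, map_one]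
  have hχ₂ : χ₂ ((γ 1 1 : ℤ) : ZMod δ) ≠ 0 :=
    ((IsUnit.of_mul_eq_one_right _ hadδ).map χ₂).ne_zero
  let φ : ZMod (N / δ) × ZMod N → ZMod (N / δ) × ZMod N := fun p =>
    (p.1 * (γ 0 0 : ℤ), ((p.1.val * δ : ℕ) : ZMod N) * (γ 0 1 : ℤ) + p.2 * (γ 1 1 : ℤ))
  have hφ : Function.Injective φ := by
    rintro ⟨a, m⟩ ⟨a', m'⟩ h
    obtain ⟨h1, h2⟩ := Prod.mk.inj h
    obtain rfl : a = a' := (IsUnit.of_mul_eq_one _ hadM).mul_left_injective h1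
    obtain rfl : m = m' :=
      (IsUnit.of_mul_eq_one_right _ hadN).mul_left_injective (add_left_cancel h2)
    rfl
  unfold slashf
  rw [E0chi_eq_sum k N δ hdvd, E0chi_eq_sum k N δ hdvd, Finset.mul_sum, Finset.mul_sum]
  refine Fintype.sum_bijective φ (Finite.injective_iff_bijective.mp hφ) _ _ fun ⟨a, m⟩ => ?_
  have hcond :
      ZMod.castHom (Nat.gcd_dvd_right δ (N / δ)) (ZMod (Nat.gcd δ (N / δ))) (φ (a, m)).1 *
        ZMod.castHom hgN (ZMod (Nat.gcd δ (N / δ))) (φ (a, m)).2 =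
      ZMod.castHom (Nat.gcd_dvd_right δ (N / δ)) (ZMod (Nat.gcd δ (N / δ))) a *
        ZMod.castHom hgN (ZMod (Nat.gcd δ (N / δ))) m := by
    simp only [φ, map_mul, map_add, map_natCast, map_intCast, Nat.cast_mul, hδg]
    linear_combination (ZMod.castHom (Nat.gcd_dvd_right δ (N / δ)) (ZMod (Nat.gcd δ (N / δ))) a *
        ZMod.castHom hgN (ZMod (Nat.gcd δ (N / δ))) m) * hadg
  have hcast : ZMod.castHom hdvd (ZMod δ) (φ (a, m)).2 =
      ZMod.castHom hdvd (ZMod δ) m * (γ 1 1 : ℤ) := by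
    simp only [φ, map_mul, map_add, map_natCast, map_intCast, Nat.cast_mul, ZMod.natCast_self]
    ring
  unfold E0chiTerm
  rw [hcond, hcast]
  simp only [mul_ite, mul_zero]
  congr 1
  rw [mul_left_comm, Ek_slash]
  simp only [φ, natCast_val_mul_intCast_mul hdvd, hc, mul_zero, add_zero, map_mul, mul_inv]
  generalize Ek k N _ τ = E
  field_simp
  linear_combination (-χ₁ a * E * (χ₂ (ZMod.castHom hdvd (ZMod δ) m))⁻¹) * hχ₁

/-- The nebentypus orbital sums transform under `Γ₀(N)` by the
character `χ` (product of the level-raisings of `χ₁` and `χ₂`): `F|_k γ = χ(d)·F` and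
`F₀|_k γ = χ(d)·F₀` for all `γ = [[a,b],[c,d]] ∈ Γ₀(N)`. -/
theorem nebentypus_transformation (N k : ℕ) (hN : 3 ≤ N) (hk : 3 ≤ k)
    (δ : ℕ) (hδ : 1 ≤ δ) (hδ2 : 2 * δ < N) (hdvd : δ ∣ N)
    (l₀ : ℤ) (hl₀ : Int.gcd l₀ ((Nat.gcd δ (N / δ) : ℤ)) = 1)
    (χ₁ : DirichletCharacter ℂ (N / δ)) (χ₂ : DirichletCharacter ℂ δ) :
    ∀ γ ∈ CongruenceSubgroup.Gamma0 N,
      (slashf (k : ℤ) γ (E0chi k N δ l₀ χ₁ χ₂) =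
        fun τ => (DirichletCharacter.changeLevel (Nat.div_dvd_of_dvd hdvd) χ₁ *
            DirichletCharacter.changeLevel hdvd χ₂) ((γ 1 1 : ℤ) : ZMod N) *
          E0chi k N δ l₀ χ₁ χ₂ τ) ∧
      (slashf (k : ℤ) γ
          (F0chi k N (DirichletCharacter.changeLevel (Nat.div_dvd_of_dvd hdvd) χ₁ *
            DirichletCharacter.changeLevel hdvd χ₂)) =
        fun τ => (DirichletCharacter.changeLevel (Nat.div_dvd_of_dvd hdvd) χ₁ *
            DirichletCharacter.changeLevel hdvd χ₂) ((γ 1 1 : ℤ) : ZMod N) *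
          F0chi k N (DirichletCharacter.changeLevel (Nat.div_dvd_of_dvd hdvd) χ₁ *
            DirichletCharacter.changeLevel hdvd χ₂) τ) := by
  intro γ hγ
  have : NeZero N := ⟨by omega⟩
  have : NeZero (N / δ) := ⟨(Nat.div_pos (Nat.le_of_dvd (by omega) hdvd) hδ).ne'⟩
  refine ⟨funext fun τ => ?_, funext fun τ => F0chi_slash k N _ hγ τ⟩
  have hd : IsUnit ((γ 1 1 : ℤ) : ZMod N) :=
    .of_mul_eq_one_right _ (Gamma0_upper_left_mul_lower_right hγ dvd_rfl)
  rw [E0chi_slash k N δ hdvd l₀ χ₁ χ₂ hγ, MulChar.mul_apply]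
  rw [← hd.unit_spec, DirichletCharacter.changeLevel_eq_cast_of_dvd,
    DirichletCharacter.changeLevel_eq_cast_of_dvd, hd.unit_spec,
    ZMod.cast_intCast (Nat.div_dvd_of_dvd hdvd), ZMod.cast_intCast hdvd]
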